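/- arXiv:1903.08764 — 8 statements merged into one kernel-verified Lean document; each statement's English description precedes it below -/
import Mathlib

section
/- Under the linear fixed-point setup, let W₁ and W₂ be d×d matrices such that W := (G−I)⁻¹W₁ + W₂ is symmetric positive definite. Assume the N×N matrix YᵀW₁R + RᵀW₂R is invertible and 1_Nᵀ(YᵀW₁R + RᵀW₂R)⁻¹1_N ≠ 0. Then the unique minimizer of γ ↦ ‖Rγ‖_W over {γ ∈ ℝ^N : 1_Nᵀγ = 1} is γ_W = (YᵀW₁R + RᵀW₂R)⁻¹1_N / (1_Nᵀ(YᵀW₁R + RᵀW₂R)⁻¹1_N). -/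
open Matrix

/-- Weighted Euclidean norm `‖v‖_W = √(vᵀ W v)`. -/
noncomputable def wNorm {d : ℕ} (W : Matrix (Fin d) (Fin d) ℝ) (v : Fin d → ℝ) : ℝ :=
  Real.sqrt (v ⬝ᵥ (W *ᵥ v))

/-- A matrix `G` with `G ⪯ (1 - κ) I` for some `κ > 0` does not have the eigenvalue `1`. -/
theorem isUnit_det_sub_one_of_posSemidef {n : Type*} [Fintype n] [DecidableEq n] {κ : ℝ}
    (hκ : 0 < κ) {G : Matrix n n ℝ} (hG : ((1 - κ) • (1 : Matrix n n ℝ) - G).PosSemidef) :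
    IsUnit (G - 1).det := by
  have hpos : (1 - G).PosDef := by
    have h := Matrix.PosDef.posSemidef_add hG ((Matrix.PosDef.one (n := n) (R := ℝ)).smul hκ)
    rwa [sub_smul, one_smul, sub_right_comm, sub_add_cancel] at h
  rw [← Matrix.isUnit_iff_isUnit_det, ← neg_sub, IsUnit.neg_iff]
  exact hpos.isUnit

/-- On directions orthogonal to the all-ones vector, the bilinear form of `Yᵀ W₁ R + Rᵀ W₂ R`
is the pullback along `R` of the form of `A⁻¹ W₁ + W₂`, where `R = A (Y - x* 1ᵀ)`. -/
theorem dotProduct_mulVec_eq_of_dotProduct_one_eq_zero {m n : Type*} [Fintype m] [Fintype n]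
    [DecidableEq m] {A : Matrix m m ℝ} (hA : IsUnit A.det) (hAsymm : A.IsSymm) (x : m → ℝ)
    {Y R : Matrix m n ℝ} (hR : R = A * (Y - Matrix.of fun i _ => x i)) (W₁ W₂ : Matrix m m ℝ)
    {δ : n → ℝ} (hδ : (fun _ => (1 : ℝ)) ⬝ᵥ δ = 0) (γ : n → ℝ) :
    δ ⬝ᵥ ((Yᵀ * W₁ * R + Rᵀ * W₂ * R) *ᵥ γ) =
      (R *ᵥ δ) ⬝ᵥ ((A⁻¹ * W₁ + W₂) *ᵥ (R *ᵥ γ)) := by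
  have hx : (Matrix.of fun (i : m) (_ : n) => x i) *ᵥ δ = 0 := by
    ext i
    simp only [dotProduct, one_mul] at hδ
    simp [mulVec, dotProduct, ← Finset.mul_sum, hδ]
  have hY : Y *ᵥ δ = A⁻¹ *ᵥ (R *ᵥ δ) := by
    rw [hR, mulVec_mulVec, Matrix.nonsing_inv_mul_cancel_left _ _ hA, sub_mulVec, hx, sub_zero]
  have hAinv : (A⁻¹)ᵀ = A⁻¹ := by rw [transpose_nonsing_inv, hAsymm.eq]
  rw [add_mulVec, add_mulVec, dotProduct_add, dotProduct_add]
  simp only [← mulVec_mulVec, dotProduct_transpose_mulVec, hY]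
  rw [← dotProduct_transpose_mulVec, hAinv, dotProduct_comm (W₂ *ᵥ R *ᵥ γ)]

/-- under the linear fixed-point setup, if `W = (G−I)⁻¹W₁ + W₂` is
symmetric positive definite, `YᵀW₁R + RᵀW₂R` is invertible and
`1ᵀ(YᵀW₁R + RᵀW₂R)⁻¹1 ≠ 0`, then `γ_W = (YᵀW₁R + RᵀW₂R)⁻¹1 / (1ᵀ(YᵀW₁R + RᵀW₂R)⁻¹1)`
is the unique minimizer of `γ ↦ ‖Rγ‖_W` over `{γ : 1ᵀγ = 1}`. -/
theorem stmt2 {d N : ℕ} (hN0 : 0 < N)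
    (κ : ℝ) (hκ0 : 0 < κ) (hκ1 : κ < 1)
    (G : Matrix (Fin d) (Fin d) ℝ) (hGsymm : G.IsSymm)
    (hGpos : G.PosSemidef) (hGub : ((1 - κ) • (1 : Matrix (Fin d) (Fin d) ℝ) - G).PosSemidef)
    (xstar : Fin d → ℝ)
    (X Y : Matrix (Fin d) (Fin N) ℝ)
    (hXrank : Function.Injective X.mulVec) (hYrank : Function.Injective Y.mulVec)
    (Xstar : Matrix (Fin d) (Fin N) ℝ) (hXstar : Xstar = Matrix.of fun i _ => xstar i)
    (hX : X = G * (Y - Xstar) + Xstar)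
    (R : Matrix (Fin d) (Fin N) ℝ) (hR : R = X - Y)
    (W₁ W₂ W : Matrix (Fin d) (Fin d) ℝ)
    (hWdef : W = (G - 1)⁻¹ * W₁ + W₂) (hW : W.PosDef)
    (M : Matrix (Fin N) (Fin N) ℝ) (hM : M = Yᵀ * W₁ * R + Rᵀ * W₂ * R)
    (hMinv : IsUnit M.det)
    (hs : (fun _ => (1:ℝ)) ⬝ᵥ (M⁻¹ *ᵥ (fun _ => (1:ℝ))) ≠ 0) :
    ∀ γW : Fin N → ℝ,
      γW = ((fun _ => (1:ℝ)) ⬝ᵥ (M⁻¹ *ᵥ (fun _ => (1:ℝ))))⁻¹ •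
        (M⁻¹ *ᵥ (fun _ => (1:ℝ))) →
      (fun _ => (1:ℝ)) ⬝ᵥ γW = 1 ∧
      (∀ γ : Fin N → ℝ, (fun _ => (1:ℝ)) ⬝ᵥ γ = 1 →
        wNorm W (R *ᵥ γW) ≤ wNorm W (R *ᵥ γ)) ∧
      (∀ γ : Fin N → ℝ, (fun _ => (1:ℝ)) ⬝ᵥ γ = 1 →
        wNorm W (R *ᵥ γ) = wNorm W (R *ᵥ γW) → γ = γW) := by
  rintro γW hγW
  set e : Fin N → ℝ := fun _ => 1
  set s : ℝ := e ⬝ᵥ (M⁻¹ *ᵥ e)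
  have hA : IsUnit (G - 1).det := isUnit_det_sub_one_of_posSemidef hκ0 hGub
  have hAsymm : (G - 1).IsSymm := hGsymm.sub isSymm_one
  have hRA : R = (G - 1) * (Y - Matrix.of fun i _ => xstar i) := by
    rw [hR, hX, hXstar, Matrix.sub_mul, Matrix.one_mul]
    abel
  have hform (δ γ : Fin N → ℝ) (hδ : e ⬝ᵥ δ = 0) :
      δ ⬝ᵥ (M *ᵥ γ) = (R *ᵥ δ) ⬝ᵥ (W *ᵥ (R *ᵥ γ)) := by
    rw [hM, hWdef]
    exact dotProduct_mulVec_eq_of_dotProduct_one_eq_zero hA hAsymm xstar hRA W₁ W₂ hδ γ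
  have hsum : e ⬝ᵥ γW = 1 := by
    rw [hγW, dotProduct_smul, smul_eq_mul, inv_mul_cancel₀ hs]
  have hMγ : M *ᵥ γW = s⁻¹ • e := by
    rw [hγW, mulVec_smul, mulVec_mulVec, Matrix.mul_nonsing_inv _ hMinv, one_mulVec]
  have hsub (γ : Fin N → ℝ) (hγ : e ⬝ᵥ γ = 1) : e ⬝ᵥ (γ - γW) = 0 := by
    rw [dotProduct_sub, hγ, hsum, sub_self]
  have hWsymm : Wᵀ = W := by simpa using hW.isHermitian.eq
  have hpyth (γ : Fin N → ℝ) (hγ : e ⬝ᵥ γ = 1) :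
      (R *ᵥ γ) ⬝ᵥ (W *ᵥ (R *ᵥ γ)) = (R *ᵥ γW) ⬝ᵥ (W *ᵥ (R *ᵥ γW)) +
        (R *ᵥ (γ - γW)) ⬝ᵥ (W *ᵥ (R *ᵥ (γ - γW))) := by
    have hcross : (R *ᵥ (γ - γW)) ⬝ᵥ (W *ᵥ (R *ᵥ γW)) = 0 := by
      rw [← hform _ _ (hsub γ hγ), hMγ, dotProduct_smul, dotProduct_comm, hsub γ hγ, smul_zero]
    have hcross' : (R *ᵥ γW) ⬝ᵥ (W *ᵥ (R *ᵥ (γ - γW))) = 0 := by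
      rw [dotProduct_mulVec, ← mulVec_transpose, hWsymm, dotProduct_comm, hcross]
    have hγ_eq : R *ᵥ γ = R *ᵥ γW + R *ᵥ (γ - γW) := by
      rw [← mulVec_add, add_sub_cancel]
    rw [hγ_eq, mulVec_add, add_dotProduct, dotProduct_add, dotProduct_add, hcross, hcross']
    ring
  have hnonneg (v : Fin d → ℝ) : 0 ≤ v ⬝ᵥ (W *ᵥ v) := by
    simpa using hW.posSemidef.dotProduct_mulVec_nonneg v
  refine ⟨hsum, fun γ hγ => Real.sqrt_le_sqrt ?_, fun γ hγ heq => ?_⟩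
  · rw [hpyth γ hγ]
    exact le_add_of_nonneg_right (hnonneg _)
  · have hsq := (Real.sqrt_inj (hnonneg _) (hnonneg _)).mp heq
    rw [hpyth γ hγ, add_eq_left] at hsq
    have hRδ : R *ᵥ (γ - γW) = 0 := by
      by_contra hne
      exact (hW.dotProduct_mulVec_pos hne).ne' (by simpa using hsq)
    have hMδ : M *ᵥ (γ - γW) = 0 := by
      simp only [hM, add_mulVec, ← mulVec_mulVec, hRδ, mulVec_zero, add_zero]
    exact sub_eq_zero.mp
      (Matrix.mulVec_injective_of_isUnit ((Matrix.isUnit_iff_isUnit_det M).mpr hMinv)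
        (hMδ.trans (mulVec_zero M).symm))
end

section
/- Consider the iteration x_i = G(y_{i−1} − x*) + x* and y_i = Σ_{k=1}^{i} α_k^{(i)} x_k for i ≥ 1, started from y₀ ∈ ℝ^d, where for each i the real coefficients satisfy Σ_{k=1}^{i} α_k^{(i)} = 1 and α_i^{(i)} ≠ 0. Then for every i ≥ 0 there exists a real polynomial p_i of degree exactly i with p_i(1) = 1 such that y_i − x* = p_i(G)(y₀ − x*). -/
open Matrix Polynomial

theorem Finset.sum_Icc_one_succ {M : Type*} [AddCommMonoid M] (f : ℕ → M) (n : ℕ) :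
    ∑ k ∈ Finset.Icc 1 (n + 1), f k = ∑ k ∈ Finset.range (n + 1), f (k + 1) := by
  rw [← Finset.Ico_add_one_right_eq_Icc, Finset.sum_Ico_eq_sum_range]
  simp [add_comm]

/-- A combination `∑ k ≤ n, a k • (X * p k)` with `p k` of degree `k` and `a n ≠ 0` has degree
`n + 1`. -/
theorem Polynomial.natDegree_sum_range_C_mul_X_mul {R : Type*} [CommRing R] [IsDomain R]
    (a : ℕ → R) (p : ℕ → R[X]) (n : ℕ) (hp : ∀ k ≤ n, (p k).natDegree = k)
    (hpn : p n ≠ 0) (ha : a n ≠ 0) :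
    (∑ k ∈ Finset.range (n + 1), C (a k) * (X * p k)).natDegree = n + 1 := by
  have hlead : (C (a n) * (X * p n)).natDegree = n + 1 := by
    rw [natDegree_C_mul ha, natDegree_X_mul hpn, hp n le_rfl]
  have hlow : (∑ k ∈ Finset.range n, C (a k) * (X * p k)).natDegree ≤ n := by
    refine natDegree_sum_le_of_forall_le _ _ fun k hk => ?_
    have hk' : k < n := Finset.mem_range.mp hk
    calc (C (a k) * (X * p k)).natDegree ≤ (X * p k).natDegree := natDegree_C_mul_le _ _
      _ ≤ (X : R[X]).natDegree + (p k).natDegree := natDegree_mul_le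
      _ ≤ n := by rw [natDegree_X, hp k hk'.le]; lia
  rw [Finset.sum_range_succ, natDegree_add_eq_right_of_natDegree_lt (by lia), hlead]

/-- for the iteration `x_i = G(y_{i−1} − x*) + x*`,
`y_i = Σ_{k=1}^{i} α_k^{(i)} x_k` with `Σ_{k=1}^{i} α_k^{(i)} = 1` and `α_i^{(i)} ≠ 0`,
for every `i` there is a real polynomial `p_i` of degree exactly `i` with `p_i(1) = 1`
such that `y_i − x* = p_i(G)(y₀ − x*)`. -/
theorem stmt3 {d : ℕ} (G : Matrix (Fin d) (Fin d) ℝ) (xstar : Fin d → ℝ)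
    (x y : ℕ → (Fin d → ℝ)) (α : ℕ → ℕ → ℝ)
    (hsum : ∀ i, 1 ≤ i → (∑ k ∈ Finset.Icc 1 i, α i k) = 1)
    (hlast : ∀ i, 1 ≤ i → α i i ≠ 0)
    (hx : ∀ i, x (i + 1) = G *ᵥ (y i - xstar) + xstar)
    (hy : ∀ i, 1 ≤ i → y i = ∑ k ∈ Finset.Icc 1 i, α i k • x k) :
    ∀ i : ℕ, ∃ p : Polynomial ℝ, p.natDegree = i ∧ p.eval 1 = 1 ∧
      y i - xstar = (Polynomial.aeval G p) *ᵥ (y 0 - xstar) := by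
  intro i
  induction i using Nat.strong_induction_on with
  | _ i ih =>
    rcases i with _ | n
    · exact ⟨1, by simp⟩
    choose! p hdeg heval hp using ih
    have hs : ∑ k ∈ Finset.range (n + 1), α (n + 1) (k + 1) = 1 := by
      rw [← Finset.sum_Icc_one_succ, hsum _ (by lia)]
    refine ⟨∑ k ∈ Finset.range (n + 1), C (α (n + 1) (k + 1)) * (X * p k), ?_, ?_, ?_⟩
    · refine natDegree_sum_range_C_mul_X_mul (fun k => α (n + 1) (k + 1)) p n
        (fun k hk => hdeg k (by lia)) ?_ (hlast _ (by lia))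
      intro h0
      simpa [h0] using heval n (by lia)
    · rw [eval_finsetSum]
      refine Eq.trans (Finset.sum_congr rfl fun k hk => ?_) hs
      simp [heval k (Finset.mem_range.mp hk)]
    · rw [hy _ (by lia), Finset.sum_Icc_one_succ, map_sum, Matrix.sum_mulVec]
      calc ∑ k ∈ Finset.range (n + 1), α (n + 1) (k + 1) • x (k + 1) - xstar
          = ∑ k ∈ Finset.range (n + 1), α (n + 1) (k + 1) • (x (k + 1) - xstar) := by
            simp only [smul_sub, Finset.sum_sub_distrib, ← Finset.sum_smul, hs, one_smul]
        _ = _ := by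
            refine Finset.sum_congr rfl fun k hk => ?_
            rw [hx, add_sub_cancel_right, hp k (Finset.mem_range.mp hk), map_mul,
              map_mul, aeval_X, aeval_C, Matrix.mulVec_mulVec, Algebra.algebraMap_eq_smul_one,
              smul_one_mul, Matrix.smul_mulVec]
end

section
/- Under the linear fixed-point setup, suppose y_k − x* = p_k(G)(y₀ − x*) for k = 0,…,N−1, where each p_k is a real polynomial of degree exactly k with p_k(1) = 1, and let R have columns r_k = (G−I)(y_{k−1} − x*), k = 1,…,N. Let γ̃, γ' ∈ ℝ^N satisfy 1_Nᵀγ̃ = 1, 1_Nᵀγ' = 1 and γ'_N ≠ 0, and let β ≠ 0 be a real number. Then the extrapolation y^extr = Yγ̃ + βRγ' satisfies y^extr − x* = q(G)(y₀ − x*) for some real polynomial q of degree exactly N with q(1) = 1. -/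
open Matrix Polynomial

/-- A combination of polynomials `p k` of degree `k`, `k < N`, has degree less than `N`. -/
lemma coeff_sum_C_mul_eq_zero {N : ℕ} (p : Fin N → ℝ[X])
    (hdeg : ∀ k, (p k).natDegree = (k : ℕ)) (c : Fin N → ℝ) {n : ℕ} (hn : N ≤ n) :
    (∑ k, C (c k) * p k).coeff n = 0 := by
  rw [finsetSum_coeff]
  refine Finset.sum_eq_zero fun k _ => ?_
  rw [coeff_C_mul, coeff_eq_zero_of_natDegree_lt (by rw [hdeg]; omega), mul_zero]

/-- The top coefficient of such a combination comes from the last polynomial only. -/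
lemma coeff_last_sum_C_mul {M : ℕ} (p : Fin (M + 1) → ℝ[X])
    (hdeg : ∀ k, (p k).natDegree = (k : ℕ)) (c : Fin (M + 1) → ℝ) :
    (∑ k, C (c k) * p k).coeff M = c (Fin.last M) * (p (Fin.last M)).leadingCoeff := by
  rw [Fin.sum_univ_castSucc, coeff_add,
    coeff_sum_C_mul_eq_zero (fun k => p k.castSucc) (fun k => by simp [hdeg])
      (fun k => c k.castSucc) le_rfl,
    zero_add, coeff_C_mul, leadingCoeff, hdeg, Fin.val_last]

lemma eval_one_sum_C_mul {N : ℕ} (p : Fin N → ℝ[X]) (heval : ∀ k, (p k).eval 1 = 1)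
    (c : Fin N → ℝ) : (∑ k, C (c k) * p k).eval 1 = ∑ k, c k := by
  simp [eval_finsetSum, heval]

lemma aeval_sum_C_mul_mulVec {d N : ℕ} (G : Matrix (Fin d) (Fin d) ℝ) (p : Fin N → ℝ[X])
    (c : Fin N → ℝ) (v : Fin d → ℝ) :
    aeval G (∑ k, C (c k) * p k) *ᵥ v = ∑ k, c k • (aeval G (p k) *ᵥ v) := by
  simp only [map_sum, ← smul_eq_C_mul, map_smul, Matrix.sum_mulVec, Matrix.smul_mulVec]

lemma of_columns_mulVec {d N : ℕ} (u : Fin N → Fin d → ℝ) (c : Fin N → ℝ) :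
    (Matrix.of fun i k => u k i) *ᵥ c = ∑ k, c k • u k := by
  ext i
  simp [Matrix.mulVec, dotProduct, mul_comm]

/-- if `y_k − x* = p_k(G)(y₀ − x*)` with `p_k` of degree exactly `k` and
`p_k(1) = 1`, `R` has columns `r_k = (G−I)(y_{k−1} − x*)`, `1ᵀγ̃ = 1`, `1ᵀγ' = 1`,
`γ'_N ≠ 0` and `β ≠ 0`, then `y^extr = Yγ̃ + βRγ'` satisfies
`y^extr − x* = q(G)(y₀ − x*)` for some polynomial `q` of degree exactly `N` with
`q(1) = 1`. -/
theorem stmt9 {d N : ℕ} (hN0 : 0 < N)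
    (κ : ℝ) (hκ0 : 0 < κ) (hκ1 : κ < 1)
    (G : Matrix (Fin d) (Fin d) ℝ) (hGsymm : G.IsSymm)
    (hGpos : G.PosSemidef) (hGub : ((1 - κ) • (1 : Matrix (Fin d) (Fin d) ℝ) - G).PosSemidef)
    (xstar : Fin d → ℝ)
    (y : Fin N → (Fin d → ℝ))
    (pfam : Fin N → Polynomial ℝ)
    (hdeg : ∀ k : Fin N, (pfam k).natDegree = (k : ℕ))
    (heval : ∀ k : Fin N, (pfam k).eval 1 = 1)
    (hy : ∀ k : Fin N, y k - xstar =
      (Polynomial.aeval G (pfam k)) *ᵥ (y ⟨0, hN0⟩ - xstar))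
    (Y R : Matrix (Fin d) (Fin N) ℝ)
    (hY : Y = Matrix.of fun i k => y k i)
    (hRcol : R = Matrix.of fun i k => ((G - 1) *ᵥ (y k - xstar)) i)
    (γt γ' : Fin N → ℝ)
    (hγt : (fun _ => (1:ℝ)) ⬝ᵥ γt = 1) (hγ' : (fun _ => (1:ℝ)) ⬝ᵥ γ' = 1)
    (hγlast : γ' ⟨N - 1, by omega⟩ ≠ 0)
    (β : ℝ) (hβ : β ≠ 0)
    (yextr : Fin d → ℝ) (hyextr : yextr = Y *ᵥ γt + β • (R *ᵥ γ')) :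
    ∃ q : Polynomial ℝ, q.natDegree = N ∧ q.eval 1 = 1 ∧
      yextr - xstar = (Polynomial.aeval G q) *ᵥ (y ⟨0, hN0⟩ - xstar) := by
  obtain ⟨M, rfl⟩ : ∃ M, N = M + 1 := ⟨N - 1, by omega⟩
  have hsum_t : ∑ k, γt k = 1 := by simpa [dotProduct] using hγt
  set S := ∑ k, C (γt k) * pfam k with hS
  set T := ∑ k, C (γ' k) * pfam k
  have hcoeff_of_gt : ∀ n, M + 1 ≤ n →
      (S + C β * ((X - 1) * T)).coeff n = β * T.coeff (n - 1) := by
    intro n hn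
    obtain ⟨m, rfl⟩ : ∃ m, n = m + 1 := ⟨n - 1, by omega⟩
    rw [coeff_add, coeff_C_mul, sub_mul, one_mul, coeff_sub, coeff_X_mul,
      coeff_sum_C_mul_eq_zero pfam hdeg γt hn, coeff_sum_C_mul_eq_zero pfam hdeg γ' hn]
    simp
  refine ⟨S + C β * ((X - 1) * T), natDegree_eq_of_le_of_coeff_ne_zero ?_ ?_, ?_, ?_⟩
  · refine natDegree_le_iff_coeff_eq_zero.2 fun n hn => ?_
    rw [hcoeff_of_gt n (by omega), coeff_sum_C_mul_eq_zero pfam hdeg γ' (by omega), mul_zero]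
  · rw [hcoeff_of_gt _ le_rfl, Nat.add_sub_cancel, coeff_last_sum_C_mul pfam hdeg]
    refine mul_ne_zero hβ (mul_ne_zero hγlast (leadingCoeff_ne_zero.2 fun h => ?_))
    simpa [h] using heval (Fin.last M)
  · simp [hS, eval_one_sum_C_mul pfam heval, hsum_t]
  · have hYt : Y *ᵥ γt - xstar = aeval G S *ᵥ (y ⟨0, hN0⟩ - xstar) := by
      rw [aeval_sum_C_mul_mulVec, hY, of_columns_mulVec]
      simp only [← hy, smul_sub, Finset.sum_sub_distrib, ← Finset.sum_smul, hsum_t, one_smul]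
    have hR' : R *ᵥ γ' = (G - 1) *ᵥ (aeval G T *ᵥ (y ⟨0, hN0⟩ - xstar)) := by
      rw [aeval_sum_C_mul_mulVec, hRcol, of_columns_mulVec fun k => (G - 1) *ᵥ (y k - xstar)]
      simp only [← hy, Matrix.mulVec_sum, Matrix.mulVec_smul]
    rw [hyextr, add_sub_right_comm, hYt, hR', ← smul_eq_C_mul]
    simp [Matrix.add_mulVec, Matrix.smul_mulVec, Matrix.mulVec_mulVec]
end

section
/- Let Y and R be d×N real matrices, let C be an N×(N−1) real matrix of full column rank with Cᵀ1_N = 0, and let H be a d×d matrix satisfying the multi-secant equation H·(RC) = YC. Then the generalized quasi-Newton step is invariant in the combination coefficients: for all γ₁, γ₂ ∈ ℝ^N with 1_Nᵀγ₁ = 1 and 1_Nᵀγ₂ = 1, one has (Y − HR)γ₁ = (Y − HR)γ₂. -/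
open Matrix

/-- The columns of an injective `N × (N - 1)` matrix orthogonal to a nonzero vector `v` span the
orthogonal complement of `v`. -/
theorem range_mulVecLin_eq_ker_dotProduct {K : Type*} [Field K] {N : ℕ}
    (C : Matrix (Fin N) (Fin (N - 1)) K) (hC : Function.Injective C.mulVec)
    {v : Fin N → K} (hv : v ≠ 0) (hCv : Cᵀ *ᵥ v = 0) :
    LinearMap.range C.mulVecLin = LinearMap.ker (dotProductEquiv K (Fin N) v) := by
  have hle : LinearMap.range C.mulVecLin ≤ LinearMap.ker (dotProductEquiv K (Fin N) v) := by
    rintro _ ⟨x, rfl⟩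
    simp [dotProduct_mulVec, ← mulVec_transpose, hCv]
  have hf : dotProductEquiv K (Fin N) v ≠ 0 := by simpa using hv
  have hrange : Module.finrank K (LinearMap.range C.mulVecLin) = N - 1 := by
    rw [LinearMap.finrank_range_of_inj hC, Module.finrank_fin_fun]
  have hker := Module.Dual.finrank_ker_add_one_of_ne_zero hf
  rw [Module.finrank_fin_fun] at hker
  exact Submodule.eq_of_le_of_finrank_eq hle (by omega)

/-- if `C` is an `N×(N−1)` matrix of full column rank with `Cᵀ1 = 0` and
`H` satisfies the multi-secant equation `H(RC) = YC`, then the generalized quasi-Newton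
step `(Y − HR)γ` is the same for all `γ` with `1ᵀγ = 1`. -/
theorem stmt10 {d N : ℕ} (hN0 : 0 < N)
    (Y R : Matrix (Fin d) (Fin N) ℝ)
    (C : Matrix (Fin N) (Fin (N - 1)) ℝ)
    (hCrank : Function.Injective C.mulVec)
    (hC1 : Cᵀ *ᵥ (fun _ => (1:ℝ)) = 0)
    (H : Matrix (Fin d) (Fin d) ℝ)
    (hH : H * (R * C) = Y * C) :
    ∀ γ₁ γ₂ : Fin N → ℝ, (fun _ => (1:ℝ)) ⬝ᵥ γ₁ = 1 → (fun _ => (1:ℝ)) ⬝ᵥ γ₂ = 1 →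
      (Y - H * R) *ᵥ γ₁ = (Y - H * R) *ᵥ γ₂ := by
  intro γ₁ γ₂ h₁ h₂
  have hv : (fun _ : Fin N => (1 : ℝ)) ≠ 0 := fun h => one_ne_zero (congrFun h ⟨0, hN0⟩)
  have hmem : γ₁ - γ₂ ∈ LinearMap.ker (dotProductEquiv ℝ (Fin N) fun _ => (1 : ℝ)) := by
    rw [LinearMap.mem_ker, dotProductEquiv_apply_apply, dotProduct_sub, h₁, h₂, sub_self]
  rw [← range_mulVecLin_eq_ker_dotProduct C hCrank hv hC1] at hmem
  obtain ⟨x, hx⟩ := hmem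
  rw [mulVecLin_apply] at hx
  rw [← sub_eq_zero, ← mulVec_sub, ← hx, mulVec_mulVec, Matrix.sub_mul, Matrix.mul_assoc, hH,
    sub_self, zero_mulVec]
end

section
/- (Multi-secant Broyden Type-I update.) Let M be a symmetric positive definite d×d matrix, J₀ a d×d matrix, and let A = YC and B = RC be d×(N−1) matrices with A of full column rank. Then the matrix J* = J₀ + (B − J₀A)(AᵀM⁻¹A)⁻¹AᵀM⁻¹ satisfies J*A = B and is the unique minimizer of the weighted Frobenius objective J ↦ ‖J − J₀‖_M² over the affine set {J ∈ ℝ^{d×d} : JA = B}. -/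
open Matrix

/-- Squared weighted Frobenius norm `‖X‖_M² = Tr(M Xᵀ M X)`. -/
noncomputable def frobSq {d : ℕ} (M X : Matrix (Fin d) (Fin d) ℝ) : ℝ :=
  Matrix.trace (M * Xᵀ * M * X)

lemma transpose_eq_of_posDef {n : Type*} [Fintype n] {M : Matrix n n ℝ} (hM : M.PosDef) :
    Mᵀ = M := by
  simpa [conjTranspose_eq_transpose_of_trivial] using hM.isHermitian.eq

lemma frobSq_eq_trace_transpose_mul_self {d : ℕ} (P X : Matrix (Fin d) (Fin d) ℝ) :
    frobSq (Pᵀ * P) X = ((P * X * Pᵀ)ᵀ * (P * X * Pᵀ)).trace := by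
  rw [frobSq, show (P * X * Pᵀ)ᵀ * (P * X * Pᵀ) = (P * (Xᵀ * (Pᵀ * P) * X)) * Pᵀ by
    simp only [transpose_mul, transpose_transpose, Matrix.mul_assoc], trace_mul_comm _ Pᵀ]
  simp only [Matrix.mul_assoc]

open scoped MatrixOrder in
lemma exists_isUnit_transpose_mul_self {d : ℕ} {M : Matrix (Fin d) (Fin d) ℝ} (hM : M.PosDef) :
    ∃ P : Matrix (Fin d) (Fin d) ℝ, IsUnit P ∧ M = Pᵀ * P := by
  obtain ⟨P, hP⟩ := CStarAlgebra.nonneg_iff_eq_star_mul_self.mp hM.posSemidef.nonneg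
  rw [star_eq_conjTranspose, conjTranspose_eq_transpose_of_trivial] at hP
  refine ⟨P, ?_, hP⟩
  have h := hM.isUnit
  rw [hP] at h
  exact isUnit_of_mul_isUnit_right h

lemma frobSq_nonneg {d : ℕ} {M : Matrix (Fin d) (Fin d) ℝ} (hM : M.PosDef)
    (X : Matrix (Fin d) (Fin d) ℝ) : 0 ≤ frobSq M X := by
  obtain ⟨P, -, rfl⟩ := exists_isUnit_transpose_mul_self hM
  rw [frobSq_eq_trace_transpose_mul_self, ← conjTranspose_eq_transpose_of_trivial (P * X * Pᵀ)]
  exact (posSemidef_conjTranspose_mul_self _).trace_nonneg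

lemma eq_zero_of_frobSq_eq_zero {d : ℕ} {M : Matrix (Fin d) (Fin d) ℝ} (hM : M.PosDef)
    {X : Matrix (Fin d) (Fin d) ℝ} (hX : frobSq M X = 0) : X = 0 := by
  obtain ⟨P, hP, rfl⟩ := exists_isUnit_transpose_mul_self hM
  rw [frobSq_eq_trace_transpose_mul_self, ← conjTranspose_eq_transpose_of_trivial (P * X * Pᵀ),
    trace_conjTranspose_mul_self_eq_zero_iff] at hX
  have hPt : IsUnit Pᵀ := (isUnit_transpose P).mpr hP
  rwa [hPt.mul_left_eq_zero, hP.mul_right_eq_zero] at hX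

lemma frobSq_add {d : ℕ} {M : Matrix (Fin d) (Fin d) ℝ} (hM : Mᵀ = M)
    (X D : Matrix (Fin d) (Fin d) ℝ) :
    frobSq M (X + D) = frobSq M X + 2 * (M * Xᵀ * M * D).trace + frobSq M D := by
  have h : (M * Dᵀ * M * X).trace = (M * Xᵀ * M * D).trace := by
    rw [← trace_transpose (M * Dᵀ * M * X)]
    simp only [transpose_mul, transpose_transpose, hM]
    rw [← Matrix.mul_assoc, ← Matrix.mul_assoc, trace_mul_comm]
    simp only [Matrix.mul_assoc]
  simp only [frobSq, transpose_add, Matrix.mul_add, Matrix.add_mul, trace_add, h]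
  ring

/-- A matrix `X = K Aᵀ M⁻¹` is orthogonal to every `D` with `D A = 0`. -/
lemma trace_mul_transpose_mul_eq_zero {d m : ℕ} {M : Matrix (Fin d) (Fin d) ℝ} (hM : M.PosDef)
    (A K : Matrix (Fin d) (Fin m) ℝ) {D : Matrix (Fin d) (Fin d) ℝ} (hD : D * A = 0) :
    (M * (K * (Aᵀ * M⁻¹))ᵀ * M * D).trace = 0 := by
  have hdet : IsUnit M.det := (isUnit_iff_isUnit_det M).mp hM.isUnit
  have h : M * (K * (Aᵀ * M⁻¹))ᵀ * M * D = A * (Kᵀ * M * D) := by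
    simp only [transpose_mul, transpose_transpose, transpose_nonsing_inv,
      transpose_eq_of_posDef hM, Matrix.mul_assoc, mul_nonsing_inv_cancel_left _ _ hdet]
  rw [h, trace_mul_comm, Matrix.mul_assoc, hD, Matrix.mul_zero, trace_zero]

/-- multi-secant Broyden Type-I update: for `M` symmetric positive
definite, `A = YC` of full column rank and `B = RC`, the matrix
`J* = J₀ + (B − J₀A)(AᵀM⁻¹A)⁻¹AᵀM⁻¹` satisfies `J*A = B` and is the unique minimizer
of `J ↦ ‖J − J₀‖_M²` over `{J : JA = B}`. -/
theorem stmt11 {d N : ℕ}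
    (M : Matrix (Fin d) (Fin d) ℝ) (hM : M.PosDef)
    (J₀ : Matrix (Fin d) (Fin d) ℝ)
    (Y R : Matrix (Fin d) (Fin N) ℝ)
    (C : Matrix (Fin N) (Fin (N - 1)) ℝ)
    (hCrank : Function.Injective C.mulVec)
    (hC1 : Cᵀ *ᵥ (fun _ => (1:ℝ)) = 0)
    (A B : Matrix (Fin d) (Fin (N - 1)) ℝ) (hA : A = Y * C) (hB : B = R * C)
    (hArank : Function.Injective A.mulVec)
    (Jstar : Matrix (Fin d) (Fin d) ℝ)
    (hJstar : Jstar = J₀ + (B - J₀ * A) * (Aᵀ * M⁻¹ * A)⁻¹ * (Aᵀ * M⁻¹)) :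
    Jstar * A = B ∧
    (∀ J : Matrix (Fin d) (Fin d) ℝ, J * A = B →
      frobSq M (Jstar - J₀) ≤ frobSq M (J - J₀)) ∧
    (∀ J : Matrix (Fin d) (Fin d) ℝ, J * A = B →
      frobSq M (J - J₀) = frobSq M (Jstar - J₀) → J = Jstar) := by
  have hG : IsUnit (Aᵀ * M⁻¹ * A).det := by
    have h := hM.inv.conjTranspose_mul_mul_same hArank
    rw [conjTranspose_eq_transpose_of_trivial] at h
    exact (isUnit_iff_isUnit_det _).mp h.isUnit
  have hJA : Jstar * A = B := by
    rw [hJstar, Matrix.add_mul, Matrix.mul_assoc _ (Aᵀ * M⁻¹) A,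
      nonsing_inv_mul_cancel_right _ _ hG, add_sub_cancel]
  have hpyth : ∀ J : Matrix (Fin d) (Fin d) ℝ, J * A = B →
      frobSq M (J - J₀) = frobSq M (Jstar - J₀) + frobSq M (J - Jstar) := by
    intro J hJ
    have hD : (J - Jstar) * A = 0 := by rw [Matrix.sub_mul, hJ, hJA, sub_self]
    have hS : Jstar - J₀ = (B - J₀ * A) * (Aᵀ * M⁻¹ * A)⁻¹ * (Aᵀ * M⁻¹) := by
      rw [hJstar, add_sub_cancel_left]
    have horth : (M * (Jstar - J₀)ᵀ * M * (J - Jstar)).trace = 0 := by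
      rw [hS]
      exact trace_mul_transpose_mul_eq_zero hM A _ hD
    rw [← sub_add_sub_cancel' Jstar J₀ J, frobSq_add (transpose_eq_of_posDef hM), horth]
    ring
  refine ⟨hJA, fun J hJ => ?_, fun J hJ h => ?_⟩
  · rw [hpyth J hJ]
    exact le_add_of_nonneg_right (frobSq_nonneg hM _)
  · rw [hpyth J hJ, add_eq_left] at h
    exact sub_eq_zero.mp (eq_zero_of_frobSq_eq_zero hM h)
end

section
/- (Broyden Type-II step equals a preconditioned Anderson step.) Let M be a symmetric positive definite d×d matrix, let Y and R be d×N real matrices with R of full column rank, let C be an N×(N−1) matrix with Cᵀ1_N = 0, let H₀ be any d×d matrix, and let H* = H₀ + (YC − H₀RC)((RC)ᵀM RC)⁻¹(RC)ᵀM (assuming (RC)ᵀM RC invertible). Define γ_M = (RᵀMR)⁻¹1_N / (1_Nᵀ(RᵀMR)⁻¹1_N). Then (RC)ᵀM R γ_M = 0 and hence (Y − H*R)γ_M = (Y − H₀R)γ_M. -/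
open Matrix

/-- Broyden Type-II step equals a preconditioned Anderson step: with
`M` symmetric positive definite, `R` of full column rank, `Cᵀ1 = 0`,
`H* = H₀ + (YC − H₀RC)((RC)ᵀM RC)⁻¹(RC)ᵀM` and
`γ_M = (RᵀMR)⁻¹1/(1ᵀ(RᵀMR)⁻¹1)`, one has `(RC)ᵀM R γ_M = 0` and hence
`(Y − H*R)γ_M = (Y − H₀R)γ_M`. -/
theorem stmt13 {d N : ℕ}
    (M : Matrix (Fin d) (Fin d) ℝ) (hM : M.PosDef)
    (Y R : Matrix (Fin d) (Fin N) ℝ)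
    (hRrank : Function.Injective R.mulVec)
    (C : Matrix (Fin N) (Fin (N - 1)) ℝ)
    (hC1 : Cᵀ *ᵥ (fun _ => (1:ℝ)) = 0)
    (H₀ : Matrix (Fin d) (Fin d) ℝ)
    (hinv : IsUnit ((R * C)ᵀ * M * (R * C)).det)
    (Hstar : Matrix (Fin d) (Fin d) ℝ)
    (hHstar : Hstar = H₀ +
      (Y * C - H₀ * (R * C)) * ((R * C)ᵀ * M * (R * C))⁻¹ * ((R * C)ᵀ * M))
    (γM : Fin N → ℝ)
    (hγM : γM = ((fun _ => (1:ℝ)) ⬝ᵥ ((Rᵀ * M * R)⁻¹ *ᵥ (fun _ => (1:ℝ))))⁻¹ •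
      ((Rᵀ * M * R)⁻¹ *ᵥ (fun _ => (1:ℝ)))) :
    ((R * C)ᵀ * M * R) *ᵥ γM = 0 ∧
    (Y - Hstar * R) *ᵥ γM = (Y - H₀ * R) *ᵥ γM := by
  have hG : IsUnit (Rᵀ * M * R) := by
    have h := (hM.conjTranspose_mul_mul_same hRrank).isUnit
    rwa [conjTranspose_eq_transpose_of_trivial] at h
  have hcancel : ((R * C)ᵀ * M * R) * (Rᵀ * M * R)⁻¹ = Cᵀ := by
    have hassoc : (R * C)ᵀ * M * R = Cᵀ * (Rᵀ * M * R) := by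
      simp only [transpose_mul, Matrix.mul_assoc]
    rw [hassoc, Matrix.mul_assoc,
      mul_nonsing_inv _ ((isUnit_iff_isUnit_det _).mp hG), Matrix.mul_one]
  have hzero : ((R * C)ᵀ * M * R) *ᵥ γM = 0 := by
    rw [hγM, mulVec_smul, mulVec_mulVec, hcancel, hC1, smul_zero]
  refine ⟨hzero, ?_⟩
  rw [hHstar, Matrix.add_mul, sub_mulVec, sub_mulVec, add_mulVec,
    Matrix.mul_assoc _ ((R * C)ᵀ * M) R, ← mulVec_mulVec γM _ ((R * C)ᵀ * M * R), hzero,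
    mulVec_zero, add_zero]
end

section
/- (Symmetric rank-k update SR-k.) Let H₀ be a symmetric d×d real matrix, let A = YC and B = RC be d×(N−1) real matrices with AᵀB = BᵀA, set V = A − H₀B, and assume the (N−1)×(N−1) matrix VᵀB is invertible (it is symmetric under the stated hypotheses). Then H = H₀ + V(VᵀB)⁻¹Vᵀ is symmetric, satisfies the multi-secant equation HB = A, and rank(H − H₀) = rank(V); moreover, every symmetric d×d matrix H' with H'B = A satisfies rank(H' − H₀) ≥ rank(V), so H has the minimal possible rank of update among symmetric solutions of the secant system. -/
open Matrix

/-- symmetric rank-k update SR-k: with `H₀` symmetric, `A = YC`,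
`B = RC`, `AᵀB = BᵀA`, `V = A − H₀B` and `VᵀB` invertible, the matrix
`H = H₀ + V(VᵀB)⁻¹Vᵀ` is symmetric, satisfies `HB = A`, `rank(H − H₀) = rank V`, and
every symmetric `H'` with `H'B = A` satisfies `rank(H' − H₀) ≥ rank V`. -/
theorem stmt17 {d N : ℕ}
    (H₀ : Matrix (Fin d) (Fin d) ℝ) (hH₀ : H₀.IsSymm)
    (Y R : Matrix (Fin d) (Fin N) ℝ)
    (C : Matrix (Fin N) (Fin (N - 1)) ℝ)
    (hCrank : Function.Injective C.mulVec)
    (hC1 : Cᵀ *ᵥ (fun _ => (1:ℝ)) = 0)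
    (A B : Matrix (Fin d) (Fin (N - 1)) ℝ) (hA : A = Y * C) (hB : B = R * C)
    (hsymm : Aᵀ * B = Bᵀ * A)
    (V : Matrix (Fin d) (Fin (N - 1)) ℝ) (hV : V = A - H₀ * B)
    (hVB : IsUnit (Vᵀ * B).det)
    (H : Matrix (Fin d) (Fin d) ℝ)
    (hH : H = H₀ + V * (Vᵀ * B)⁻¹ * Vᵀ) :
    H.IsSymm ∧ H * B = A ∧ (H - H₀).rank = V.rank ∧
    (∀ H' : Matrix (Fin d) (Fin d) ℝ, H'.IsSymm → H' * B = A →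
      V.rank ≤ (H' - H₀).rank) := by
  have hMsymm : (Vᵀ * B)ᵀ = Vᵀ * B := by
    simp only [hV, transpose_mul, transpose_sub, transpose_transpose, Matrix.sub_mul,
      hH₀.eq, hsymm, Matrix.mul_assoc]
  have hHsymm : H.IsSymm := by
    rw [Matrix.IsSymm, hH, transpose_add, hH₀.eq, transpose_mul, transpose_mul,
      transpose_transpose, transpose_nonsing_inv, hMsymm, Matrix.mul_assoc]
  have hHB : H * B = A := by
    rw [hH, Matrix.add_mul, Matrix.mul_assoc (V * _), Matrix.mul_assoc V,
      nonsing_inv_mul _ hVB, Matrix.mul_one, hV, add_sub_cancel]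
  have hmin : ∀ H' : Matrix (Fin d) (Fin d) ℝ, H' * B = A → V.rank ≤ (H' - H₀).rank := by
    intro H' hH'
    rw [hV, ← hH', ← Matrix.sub_mul]
    exact rank_mul_le_left _ _
  refine ⟨hHsymm, hHB, le_antisymm ?_ (hmin H hHB), fun H' _ hH' => hmin H' hH'⟩
  rw [hH, add_sub_cancel_left, Matrix.mul_assoc]
  exact rank_mul_le_left _ _
end

section
/- (SR-k step equals a preconditioned Anderson step.) Let Y and R be d×N real matrices, H₀ a symmetric d×d matrix, and C an N×(N−1) matrix with Cᵀ1_N = 0. Assume the N×N matrix YᵀR − RᵀH₀R is invertible with 1_Nᵀ(YᵀR − RᵀH₀R)⁻¹1_N ≠ 0, set γ = (YᵀR − RᵀH₀R)⁻¹1_N / (1_Nᵀ(YᵀR − RᵀH₀R)⁻¹1_N), and let H = H₀ + V(VᵀRC)⁻¹Vᵀ with V = YC − H₀RC and VᵀRC invertible. Then VᵀRγ = 0, hence HRγ = H₀Rγ and the SR-k step satisfies (Y − HR)γ = (Y − H₀R)γ. -/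
open Matrix

/-- SR-k step equals a preconditioned Anderson step: with `H₀`
symmetric, `Cᵀ1 = 0`, `YᵀR − RᵀH₀R` invertible, `1ᵀ(YᵀR − RᵀH₀R)⁻¹1 ≠ 0`,
`γ = (YᵀR − RᵀH₀R)⁻¹1/(1ᵀ(YᵀR − RᵀH₀R)⁻¹1)`, `V = YC − H₀RC`, `VᵀRC` invertible and
`H = H₀ + V(VᵀRC)⁻¹Vᵀ`, one has `VᵀRγ = 0`, hence `HRγ = H₀Rγ` and
`(Y − HR)γ = (Y − H₀R)γ`. -/
theorem stmt18 {d N : ℕ}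
    (Y R : Matrix (Fin d) (Fin N) ℝ)
    (H₀ : Matrix (Fin d) (Fin d) ℝ) (hH₀ : H₀.IsSymm)
    (C : Matrix (Fin N) (Fin (N - 1)) ℝ)
    (hC1 : Cᵀ *ᵥ (fun _ => (1:ℝ)) = 0)
    (hinv : IsUnit (Yᵀ * R - Rᵀ * H₀ * R).det)
    (hs : (fun _ => (1:ℝ)) ⬝ᵥ ((Yᵀ * R - Rᵀ * H₀ * R)⁻¹ *ᵥ (fun _ => (1:ℝ))) ≠ 0)
    (γ : Fin N → ℝ)
    (hγ : γ = ((fun _ => (1:ℝ)) ⬝ᵥ ((Yᵀ * R - Rᵀ * H₀ * R)⁻¹ *ᵥ (fun _ => (1:ℝ))))⁻¹ •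
      ((Yᵀ * R - Rᵀ * H₀ * R)⁻¹ *ᵥ (fun _ => (1:ℝ))))
    (V : Matrix (Fin d) (Fin (N - 1)) ℝ) (hV : V = Y * C - H₀ * (R * C))
    (hVRC : IsUnit (Vᵀ * (R * C)).det)
    (H : Matrix (Fin d) (Fin d) ℝ)
    (hH : H = H₀ + V * (Vᵀ * (R * C))⁻¹ * Vᵀ) :
    Vᵀ *ᵥ (R *ᵥ γ) = 0 ∧
    (H * R) *ᵥ γ = (H₀ * R) *ᵥ γ ∧
    (Y - H * R) *ᵥ γ = (Y - H₀ * R) *ᵥ γ := by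
  have hVR : Vᵀ * R = Cᵀ * (Yᵀ * R - Rᵀ * H₀ * R) := by
    rw [hV]
    simp only [transpose_sub, transpose_mul, hH₀.eq, Matrix.mul_sub, Matrix.sub_mul,
      Matrix.mul_assoc]
  have hVRγ : Vᵀ *ᵥ (R *ᵥ γ) = 0 := by
    rw [mulVec_mulVec, hVR, hγ, mulVec_smul, ← mulVec_mulVec,
      mulVec_mulVec _ (Yᵀ * R - Rᵀ * H₀ * R), mul_nonsing_inv _ hinv, one_mulVec, hC1, smul_zero]
  have hHR : (H * R) *ᵥ γ = (H₀ * R) *ᵥ γ := by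
    rw [hH, ← mulVec_mulVec, add_mulVec, ← mulVec_mulVec _ _ Vᵀ, hVRγ, mulVec_zero, add_zero,
      mulVec_mulVec]
  exact ⟨hVRγ, hHR, by rw [sub_mulVec, sub_mulVec, hHR]⟩
end
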